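/- Let n ≥ 2 and let g ∈ S_n be a permutation consisting of a single (n−1)-cycle and one fixed point. Then for every l ≥ 0, n! · #{(t_1, …, t_l) transpositions in S_n with t_1⋯t_l = g} = Σ_{j=0}^{n} a_j · (n(n−1)/2 − j(n−1))^l, where the integers a_j are the coefficients of the polynomial (1 − X)^{n−2} · (1 + (n−2)X + X²) = Σ_{j=0}^{n} a_j X^j. (Equivalently, the polynomial Φ(X) of the structural theorem equals 1 + (n−2)X + X² for this element.) -/

import Mathlib

open scoped BigOperators
namespace ALC
open Finset Matrix

variable {α : Type*} [Fintype α] [DecidableEq α]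

/-- the matrix `1 - x P_w` -/
def cm {R : Type*} [CommRing R] (x : R) (w : Equiv.Perm α) : Matrix α α R :=
  Matrix.of fun i j => (if i = j then 1 else 0) - x * (if w i = j then 1 else 0)

/-- number of fixed points as a real number -/
def fx (w : Equiv.Perm α) : ℝ := ∑ i, if w i = i then (1 : ℝ) else 0

/-- the basic class function -/
noncomputable def sf (y : ℝ) (w : Equiv.Perm α) : ℝ :=
  (cm y w).det * (1 + y / (1 - y) ^ 2 * fx w)

theorem cm_det_ne {y : ℝ} (h0 : 0 < y) (h1 : y < 1) (w : Equiv.Perm α) : (cm y w).det ≠ 0 := by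
  intro h
  obtain ⟨v, hv, hv2⟩ := Matrix.exists_mulVec_eq_zero_iff.mpr h
  have e : ∀ i, v i = y * v (w i) := by
    intro i
    have := congrFun hv2 i
    simp [cm, Matrix.mulVec, dotProduct, sub_mul, Finset.sum_sub_distrib] at this
    linarith
  have e2 : ∑ i, |v i| = y * ∑ i, |v i| := by
    conv_lhs => 
      enter [2, i]
      rw [e i, abs_mul, abs_of_pos h0]
    rw [← Finset.mul_sum, Equiv.sum_comp w (fun i => |v i|)]
  have e3 : ∑ i, |v i| = 0 := by
    have : (1 - y) * ∑ i, |v i| = 0 := by linarith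
    rcases mul_eq_zero.mp this with h | h
    · linarith
    · exact h
  apply hv
  ext i
  have := (Finset.sum_eq_zero_iff_of_nonneg (fun i _ => abs_nonneg (v i))).mp e3 i (mem_univ i)
  simpa using this

/-- abstract double sum expansion -/
theorem dsum (B P : α → α → ℝ) (t f r d e1 e2 : ℝ) (n : ℝ) (hn : n = Fintype.card α)
    (ht : ∑ i, B i i = t) (hf : ∑ i, P i i = f)
    (rB : ∀ i, ∑ j, B i j = r) (cB : ∀ j, ∑ i, B i j = r)
    (rP : ∀ i, ∑ j, P i j = 1) (cP : ∀ j, ∑ i, P i j = 1)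
    (hd : ∑ i, B i i * P i i = d) (h1 : ∑ i, ∑ j, B i j * P i j = e1)
    (h2 : ∑ i, ∑ j, B i j * P j i = e2) (K c : ℝ) :
    ∑ i, ∑ j, (B i i + B j j - B i j - B j i - 1 + 2 * (if i = j then 1 else 0)) *
      (K - c * (P i i + P j j - P i j - P j i)) =
      K * (2 * n * t - 2 * n * r - n ^ 2 + 2 * n) + c * (2 * n * f - 2 * n)
      - c * (2 * n * d + 2 * t * f - 4 * t - 4 * r * f + 2 * e1 + 2 * e2) := by
  have h1' : ∑ i, ∑ j, B j i * P j i = e1 := by rw [Finset.sum_comm]; exact h1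
  have h2' : ∑ i, ∑ j, B j i * P i j = e2 := by rw [Finset.sum_comm]; exact h2
  have a1 : ∑ i, ∑ j, B j j * P i j = t := by
    rw [Finset.sum_comm]; simp [← Finset.mul_sum, cP, ht]
  have a2 : ∑ i, ∑ j, B j j * P j i = t := by
    rw [Finset.sum_comm]; simp [← Finset.mul_sum, rP, ht]
  have a3 : ∑ i, ∑ j, B i j * P j j = r * f := by
    rw [Finset.sum_comm]; simp [← Finset.sum_mul, cB, ← Finset.mul_sum, hf]
  have a4 : ∑ i, ∑ j, B j i * P j j = r * f := by
    rw [Finset.sum_comm]; simp [← Finset.sum_mul, rB, ← Finset.mul_sum, hf]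
  have key : ∀ i j, (B i i + B j j - B i j - B j i - 1 + 2 * (if i = j then 1 else 0)) *
      (K - c * (P i i + P j j - P i j - P j i)) =
      K * B i i + K * B j j - K * B i j - K * B j i - K + (if i = j then 2 * K else 0)
      + c * P i i + c * P j j - c * P i j - c * P j i 
      - c * (B i i * P i i) - c * (B i i * P j j) + c * (B i i * P i j) + c * (B i i * P j i)
      - c * (B j j * P i i) - c * (B j j * P j j) + c * (B j j * P i j) + c * (B j j * P j i)
      + c * (B i j * P i i) + c * (B i j * P j j) - c * (B i j * P i j) - c * (B i j * P j i)
      + c * (B j i * P i i) + c * (B j i * P j j) - c * (B j i * P i j) - c * (B j i * P j i) := by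
    intro i j
    split_ifs with h
    · subst h; ring
    · ring
  simp only [key, Finset.sum_add_distrib, Finset.sum_sub_distrib, ← Finset.mul_sum, h1, h2, h1', h2',
    a1, a2, a3, a4, rB, cB, rP, cP, ← Finset.sum_mul, ht, hf, hd, Finset.sum_const, Finset.card_univ,
    nsmul_eq_mul, ← hn, Finset.sum_ite_eq, Finset.mem_univ, if_true]
  have hd' : ∑ x, n * B x x * P x x = n * d := by
    rw [← hd, Finset.mul_sum]
    exact Finset.sum_congr rfl fun i _ => by ring
  ring_nf
  rw [hd']
  ring

theorem cm_swap {y : ℝ} (h0 : 0 < y) (h1 : y < 1) (w : Equiv.Perm α) (i j : α) :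
    (cm y (Equiv.swap i j * w)).det = (cm y w).det *
      ((cm y w)⁻¹ i i + (cm y w)⁻¹ j j - (cm y w)⁻¹ i j - (cm y w)⁻¹ j i - 1
        + 2 * (if i = j then 1 else 0)) := by
  have hu : IsUnit (cm y w).det := (cm_det_ne h0 h1 w).isUnit
  set v : α → ℝ := Pi.single i 1 - Pi.single j 1 with hv
  have hA : cm y (Equiv.swap i j * w) = cm y w +
      replicateCol Unit (fun k => y * v (w k)) * replicateRow Unit v := by
    ext k m
    simp only [cm, Matrix.add_apply, Matrix.of_apply, Matrix.mul_apply, replicateCol_apply,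
      replicateRow_apply, Finset.univ_unique, Finset.sum_singleton, Equiv.Perm.mul_apply, hv,
      Pi.sub_apply, Pi.single_apply, Equiv.swap_apply_def]
    grind
  have hu2 : (fun k => y * v (w k)) = v - cm y w *ᵥ v := by
    ext k
    simp [cm, Matrix.mulVec, dotProduct, sub_mul, Finset.sum_sub_distrib]
  rw [hA, Matrix.det_add_replicateCol_mul_replicateRow hu]
  congr 1
  have : (replicateRow Unit v * (cm y w)⁻¹ * replicateCol Unit fun k => y * v (w k)) = 
     Matrix.of fun _ _ => v ⬝ᵥ ((cm y w)⁻¹ *ᵥ v) - v ⬝ᵥ v := by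
    ext a b
    rw [hu2, Matrix.mul_assoc]
    have : (cm y w)⁻¹ * replicateCol Unit (v - cm y w *ᵥ v) = replicateCol Unit ((cm y w)⁻¹ *ᵥ v - v) := by
      rw [← Matrix.replicateCol_mulVec, Matrix.mulVec_sub, Matrix.mulVec_mulVec,
        Matrix.nonsing_inv_mul _ hu, Matrix.one_mulVec]
    rw [this]
    simp [Matrix.mul_apply, dotProduct, mul_sub, Finset.sum_sub_distrib]
  rw [this]
  simp only [det_unique, Matrix.add_apply, Matrix.of_apply, Matrix.one_apply_eq, hv, Matrix.mulVec_sub,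
    sub_dotProduct, dotProduct_sub, single_dotProduct, one_mul, Matrix.mulVec_single_one, 
    Matrix.col_apply, Pi.single_apply]
  grind

theorem fx_swap (w : Equiv.Perm α) (i j : α) : fx (Equiv.swap i j * w) = fx w -
    ((if w i = i then 1 else 0) + (if w j = j then 1 else 0) - (if w i = j then 1 else 0)
      - (if w j = i then 1 else 0)) := by
  set v : α → ℝ := Pi.single i 1 - Pi.single j 1 with hv
  have : ∀ k, (if (Equiv.swap i j * w) k = k then (1:ℝ) else 0) = (if w k = k then 1 else 0) - v (w k) * v k := by
    intro k
    simp only [Equiv.Perm.mul_apply, hv,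
      Pi.sub_apply, Pi.single_apply, Equiv.swap_apply_def]
    grind
  simp only [fx, this, Finset.sum_sub_distrib]
  congr 1
  simp only [hv, Pi.sub_apply, mul_sub, Pi.single_apply, mul_ite, mul_one, mul_zero, Finset.sum_sub_distrib,
    Finset.sum_ite_eq', Finset.mem_univ, if_true]
  ring

theorem det_deriv {y : ℝ} (h0 : 0 < y) (h1 : y < 1) (w : Equiv.Perm α) :
    HasDerivAt (fun y : ℝ => (cm y w).det)
      (-(cm y w).det * ∑ i, (cm y w)⁻¹ (w i) i) y := by
  have hu : IsUnit (cm y w).det := (cm_det_ne h0 h1 w).isUnit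
  set P : Matrix α α ℝ := Matrix.of fun i j => if w i = j then 1 else 0 with hP
  have hA : ∀ z, cm z w = cm y w * (1 + (z - y) • (-((cm y w)⁻¹ * P))) := by
    intro z
    rw [Matrix.mul_add, Matrix.mul_smul, Matrix.mul_neg, ← Matrix.mul_assoc,
      Matrix.mul_nonsing_inv _ hu, Matrix.one_mul, Matrix.mul_one]
    ext i j
    simp [cm, hP]
    grind
  set M := (-((cm y w)⁻¹ * P)) with hM
  set Q : Polynomial ℝ := (1 + (Polynomial.X : Polynomial ℝ) • M.map Polynomial.C).det with hQ
  have hQe : ∀ h : ℝ, Q.eval h = (1 + h • M).det := by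
    intro h
    rw [hQ, ← Polynomial.coe_evalRingHom, RingHom.map_det]
    congr 1
    ext i j
    simp [Matrix.one_apply]
    split_ifs <;> simp [mul_comm]
  have hd := Q.hasDerivAt 0
  rw [hQ, Matrix.derivative_det_one_add_X_smul, ← hQ] at hd
  have hd2 : HasDerivAt (fun z => (cm y w).det * Q.eval (z - y)) ((cm y w).det * M.trace) y := by
    have hd' : HasDerivAt (fun x => Q.eval x) M.trace (y - y) := by simpa using hd
    exact (hd'.comp_sub_const y y).const_mul _
  have e : M.trace = - ∑ i, (cm y w)⁻¹ (w i) i := by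
    rw [hM, Matrix.trace_neg, Matrix.trace_mul_comm]
    simp [Matrix.trace, Matrix.mul_apply, hP]
  rw [e] at hd2
  convert hd2 using 1
  · ext z
    rw [hQe, hA z, Matrix.det_mul]
  · ring

theorem key {y : ℝ} (h0 : 0 < y) (h1 : y < 1) (w : Equiv.Perm α) (n : ℝ)
    (hn : n = Fintype.card α) :
    ∃ s', HasDerivAt (fun z => sf z w) s' y ∧
      ∑ i, ∑ j, sf y (Equiv.swap i j * w) - n * sf y w =
        n * (n - 1) * sf y w - 2 * (n - 1) * y * s' := by
  have hu : IsUnit (cm y w).det := (cm_det_ne h0 h1 w).isUnit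
  have hy1 : (1 - y) ≠ 0 := by linarith
  have hy0 : y ≠ 0 := h0.ne'
  have hdet := det_deriv h0 h1 w
  set F := (cm y w).det with hF
  set B := (cm y w)⁻¹ with hB
  have hAB : cm y w * B = 1 := Matrix.mul_nonsing_inv _ hu
  have hBA : B * cm y w = 1 := Matrix.nonsing_inv_mul _ hu
  have k1 : ∀ i j, B i j - y * B (w i) j = if i = j then 1 else 0 := by
    intro i j
    have := congrFun (congrFun hAB i) j
    simpa [Matrix.mul_apply, cm, sub_mul, Finset.sum_sub_distrib, Matrix.one_apply] using this
  have k2 : ∀ i j, B i (w j) - y * B i j = if i = w j then 1 else 0 := by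
    intro i j
    have := congrFun (congrFun hBA i) (w j)
    simpa [Matrix.mul_apply, cm, mul_sub, Finset.sum_sub_distrib, Matrix.one_apply, mul_comm] using this
  set t := ∑ i, B i i with ht
  have rB : ∀ i, ∑ j, B i j = 1 / (1 - y) := by
    intro i
    have : ∑ j, (B i (w j) - y * B i j) = 1 := by
      simp only [k2]
      rw [Equiv.sum_comp w (fun j => if i = j then (1:ℝ) else 0)]
      simp
    rw [Finset.sum_sub_distrib, ← Finset.mul_sum, Equiv.sum_comp w (fun j => B i j)] at this
    rw [eq_div_iff hy1]; linarith
  have cB : ∀ j, ∑ i, B i j = 1 / (1 - y) := by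
    intro j
    have : ∑ i, (B i j - y * B (w i) j) = 1 := by
      simp only [k1]
      simp
    rw [Finset.sum_sub_distrib, ← Finset.mul_sum, Equiv.sum_comp w (fun i => B i j)] at this
    rw [eq_div_iff hy1]; linarith
  have hBP : ∑ i, B (w i) i = (t - n) / y := by
    have : ∑ i, (B i i - y * B (w i) i) = n := by
      simp only [k1]
      simp [hn]
    rw [Finset.sum_sub_distrib, ← Finset.mul_sum] at this
    rw [eq_div_iff hy0]; linarith
  have hBP2 : ∑ i, B i (w i) = y * t + fx w := by
    have : ∑ i, (B i (w i) - y * B i i) = fx w := by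
      simp only [k2, fx, eq_comm]
    rw [Finset.sum_sub_distrib, ← Finset.mul_sum] at this
    linarith
  have hd : ∑ i, B i i * (if w i = i then 1 else 0) = fx w / (1 - y) := by
    rw [fx, Finset.sum_div]
    refine Finset.sum_congr rfl fun i _ => ?_
    split_ifs with h
    · have := k1 i i
      rw [h, if_pos rfl] at this
      rw [mul_one, eq_div_iff hy1]; linarith
    · simp
  refine ⟨(-F * ∑ i, B (w i) i) * (1 + y / (1 - y) ^ 2 * fx w) +
    F * ((1 + y) / (1 - y) ^ 3 * fx w), ?_, ?_⟩
  · unfold sf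
    refine hdet.mul ?_
    have : HasDerivAt (fun z : ℝ => z / (1 - z) ^ 2) ((1 + y) / (1 - y) ^ 3) y := by
      have h2 : HasDerivAt (fun z : ℝ => (1 - z) ^ 2) (2 * (1 - y) * (-1)) y := by
        have := ((hasDerivAt_id y).const_sub 1).pow 2
        exact this.congr_deriv (by simp)
      have := (hasDerivAt_id y).div h2 (pow_ne_zero 2 hy1)
      refine this.congr_deriv ?_
      simp only [id]
      field_simp
      ring
    exact (this.mul_const _).const_add 1
  · have := dsum (fun i j => B i j) (fun i j => if w i = j then 1 else 0) t (fx w) (1 / (1 - y))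
      (fx w / (1 - y)) (y * t + fx w) ((t - n) / y) n hn rfl rfl rB cB (by simp)
      (by intro j; rw [Equiv.sum_comp w (fun i => if i = j then (1:ℝ) else 0)]; simp) hd
      (by simpa using hBP2)
      (by rw [Finset.sum_comm]; simpa using hBP) (1 + y / (1 - y) ^ 2 * fx w) (y / (1 - y) ^ 2)
    have e : ∀ i j, sf y (Equiv.swap i j * w) = F * ((B i i + B j j - B i j - B j i - 1
        + 2 * (if i = j then 1 else 0)) * ((1 + y / (1 - y) ^ 2 * fx w) - y / (1 - y) ^ 2 *
        ((if w i = i then 1 else 0) + (if w j = j then 1 else 0) - (if w i = j then 1 else 0)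
      - (if w j = i then 1 else 0)))) := by
      intro i j
      rw [sf, cm_swap h0 h1, fx_swap]
      ring
    simp only [e, ← Finset.mul_sum]
    rw [this, sf, hBP, ← hF]
    field_simp
    ring

theorem rowsum_dvd {m R : Type*} [Fintype m] [DecidableEq m] [CommRing R] [Nonempty m]
    (M : Matrix m m R) (c : R) (h : ∀ i, ∑ j, M i j = c) : c ∣ M.det := by
  obtain ⟨i⟩ := ‹Nonempty m›
  have h1 : M *ᵥ (fun _ => 1) = fun _ => c := by
    ext i
    simp [Matrix.mulVec, dotProduct, h]
  have h2 : M.adjugate *ᵥ (M *ᵥ (fun _ => 1)) = M.det • (fun _ => (1 : R)) := by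
    rw [Matrix.mulVec_mulVec, Matrix.adjugate_mul, Matrix.smul_mulVec, Matrix.one_mulVec]
  have h3 := congrFun h2 i
  rw [h1] at h3
  simp only [Matrix.mulVec, dotProduct, Pi.smul_apply, smul_eq_mul, mul_one, ← Finset.sum_mul] at h3
  exact ⟨_, by rw [← h3, mul_comm]⟩

theorem block_dvd {R : Type*} [CommRing R] (x : R) (w : Equiv.Perm α) {k : ℕ} (b : α → Fin k)
    (hb : Function.Surjective b) (hw : ∀ i, b (w i) = b i) : (1 - x) ^ k ∣ (cm x w).det := by
  have hT : (cm x w).BlockTriangular b := by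
    intro i j hij
    have h1 : i ≠ j := by rintro rfl; exact lt_irrefl _ hij
    have h2 : w i ≠ j := by rintro rfl; rw [hw] at hij; exact lt_irrefl _ hij
    simp [cm, h1, h2]
  rw [hT.det, Finset.image_univ_of_surjective hb]
  have : (1 - x) ^ k = ∏ a : Fin k, (1 - x) := by simp
  rw [this]
  refine Finset.prod_dvd_prod_of_dvd _ _ fun a _ => ?_
  obtain ⟨i0, hi0⟩ := hb a
  have : Nonempty {i // b i = a} := ⟨⟨i0, hi0⟩⟩
  refine rowsum_dvd _ _ fun i => ?_
  obtain ⟨i, hi⟩ := i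
  simp only [Matrix.toSquareBlock_def, Matrix.of_apply, cm, Finset.sum_sub_distrib, ← Finset.mul_sum]
  rw [Finset.sum_eq_single (⟨i, hi⟩ : {i // b i = a}), 
    Finset.sum_eq_single (⟨w i, by rw [hw, hi]⟩ : {i // b i = a})]
  · simp
  · rintro ⟨j, hj⟩ _ hne
    rw [if_neg]; rintro rfl; exact hne rfl
  · simp
  · rintro ⟨j, hj⟩ _ hne
    rw [if_neg]; rintro rfl; exact hne rfl
  · simp

theorem cycle_det {R : Type*} [CommRing R] (x : R) (w : Equiv.Perm α) (hw : w.IsCycle) :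
    (cm x w).det = (1 - x) ^ (Fintype.card α - w.support.card) * (1 - x ^ w.support.card) := by
  have hw1 : (1 : Equiv.Perm α) ≠ w := fun h => hw.ne_one h.symm
  rw [← Matrix.det_transpose, Matrix.det_apply']
  have h0 : ∀ σ ∈ (univ : Finset (Equiv.Perm α)), σ ∉ ({1, w} : Finset (Equiv.Perm α)) →
      ((Equiv.Perm.sign σ : ℤ) : R) * ∏ i, (cm x w)ᵀ (σ i) i = 0 := by
    intro σ _ hσ
    by_contra hne
    apply hσ
    have hs : ∀ i, σ i = i ∨ σ i = w i := by
      intro i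
      by_contra! hi
      apply hne
      rw [Finset.prod_eq_zero (mem_univ i), mul_zero]
      simp [cm, hi.1.symm, hi.2.symm]
    by_cases h1 : σ = 1
    · simp [h1]
    · have : ∃ i, σ i ≠ i := by
        by_contra! h
        exact h1 (Equiv.ext h)
      obtain ⟨i, hi⟩ := this
      have hwi : σ i = w i := (hs i).resolve_left hi
      have hwi' : w i ≠ i := hwi ▸ hi
      have hk : ∀ k : ℕ, σ ((w ^ k) i) = w ((w ^ k) i) ∧ w ((w ^ k) i) ≠ (w ^ k) i := by
        intro k
        induction k with
        | zero => simpa using ⟨hwi, hwi'⟩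
        | succ k ih =>
          obtain ⟨e1, e2⟩ := ih
          rw [pow_succ', Equiv.Perm.mul_apply]
          have e3 : w (w ((w ^ k) i)) ≠ w ((w ^ k) i) := fun h => e2 (w.injective h)
          refine ⟨(hs _).resolve_left ?_, e3⟩
          intro h
          rw [← e1] at h
          have := σ.injective h
          rw [e1] at this
          exact e2 this
      have : σ = w := by
        ext j
        by_cases hj : w j = j
        · rcases hs j with h | h
          · rw [h, hj]
          · exact h
        · obtain ⟨k, rfl⟩ := hw.exists_pow_eq hwi' hj
          exact (hk k).1
      simp [this]
  rw [← Finset.sum_subset (Finset.subset_univ ({1, w} : Finset (Equiv.Perm α))) h0,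
    Finset.sum_pair hw1]
  have hc : #(univ \ w.support) = Fintype.card α - #w.support := by
    rw [← Finset.compl_eq_univ_sdiff, Finset.card_compl]
  have p1 : ∏ i, (cm x w)ᵀ ((1 : Equiv.Perm α) i) i = (1 - x) ^ (Fintype.card α - #w.support) := by
    rw [← Finset.prod_sdiff (Finset.subset_univ w.support), ← hc]
    rw [Finset.prod_eq_pow_card (b := 1 - x), Finset.prod_eq_one, mul_one]
    · intro i hi
      rw [Equiv.Perm.mem_support] at hi
      simp [cm, hi]
    · intro i hi
      simp at hi
      simp [cm, hi]
  have p2 : ∏ i, (cm x w)ᵀ (w i) i = (1 - x) ^ (Fintype.card α - #w.support) * (-x) ^ #w.support := by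
    rw [← Finset.prod_sdiff (Finset.subset_univ w.support), ← hc]
    rw [Finset.prod_eq_pow_card (b := 1 - x), Finset.prod_eq_pow_card (b := -x)]
    · intro i hi
      rw [Equiv.Perm.mem_support] at hi
      simp [cm, hi.symm]
    · intro i hi
      simp at hi
      simp [cm, hi]
  rw [p1, p2, hw.sign]
  simp only [Equiv.Perm.sign_one, Units.val_one, Int.cast_one, one_mul, Units.val_neg, Int.cast_neg,
    Units.val_pow_eq_pow_val]
  rw [neg_pow x]
  push_cast
  have : ((-1 : R) ^ #w.support) * (-1) ^ #w.support = 1 := by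
    rw [← mul_pow]; simp
  linear_combination (-(1 - x) ^ (Fintype.card α - #w.support) * x ^ #w.support) * this

theorem fx_eq (w : Equiv.Perm α) : fx w = ((Fintype.card α - #w.support : ℕ) : ℝ) := by
  rw [fx, ← Finset.card_compl]
  simp only [Finset.sum_boole]
  congr 2
  ext i
  simp

theorem eval_det (y : ℝ) (w : Equiv.Perm α) :
    ((cm (Polynomial.X : Polynomial ℝ) w).det).eval y = (cm y w).det := by
  rw [← Polynomial.coe_evalRingHom, RingHom.map_det]
  congr 1
  ext i j
  simp only [cm, RingHom.mapMatrix_apply, Matrix.map_apply, Matrix.of_apply, map_sub, map_mul]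
  split_ifs <;> simp

open Filter Topology

theorem lim_conj (w : Equiv.Perm α) (hw : w.IsCycle) (hc : #w.support + 1 = Fintype.card α) :
    Tendsto (fun y => sf y w) (𝓝[<] 1) (𝓝 (#w.support : ℝ)) := by
  have h1 : Tendsto (fun y : ℝ => (1 - y) * (1 - y ^ #w.support) +
      y * ∑ k ∈ Finset.range #w.support, y ^ k) (𝓝[<] 1) (𝓝 (#w.support : ℝ)) := by
    apply tendsto_nhdsWithin_of_tendsto_nhds
    have : Continuous (fun y : ℝ => (1 - y) * (1 - y ^ #w.support) +
      y * ∑ k ∈ Finset.range #w.support, y ^ k) := by fun_prop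
    have h := this.tendsto 1
    simpa using h
  refine h1.congr' ?_
  filter_upwards [self_mem_nhdsWithin] with y hy
  have hy' : 1 - y ≠ 0 := by have : y < 1 := hy; linarith
  have hs : Fintype.card α - #w.support = 1 := by omega
  rw [sf, cycle_det y w hw, fx_eq, hs]
  have := mul_neg_geom_sum y #w.support
  rw [← this]
  field_simp
  push_cast
  ring

theorem lim_nofix [Nonempty α] (w : Equiv.Perm α) (hw : ∀ i, w i ≠ i) :
    Tendsto (fun y => sf y w) (𝓝[<] 1) (𝓝 0) := by
  have h0 : fx w = 0 := by simp [fx, hw]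
  have hd : (1 - (1:ℝ)) ^ 1 ∣ (cm (1:ℝ) w).det :=
    block_dvd 1 w (k := 1) (fun _ => 0) (fun a => ⟨Classical.arbitrary α, by
      exact Subsingleton.elim _ _⟩) (fun _ => rfl)
  simp only [sub_self, pow_one, zero_dvd_iff] at hd
  apply tendsto_nhdsWithin_of_tendsto_nhds
  simp only [sf, h0, mul_zero, add_zero, mul_one, ← eval_det] at hd ⊢
  have := ((cm (Polynomial.X : Polynomial ℝ) w).det).continuous.tendsto 1
  rwa [hd] at this

theorem lim_three (w : Equiv.Perm α) (b : α → Fin 3)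
    (hb : Function.Surjective b) (hw : ∀ i, b (w i) = b i) :
    Tendsto (fun y => sf y w) (𝓝[<] 1) (𝓝 0) := by
  obtain ⟨Q, hQ⟩ := block_dvd (Polynomial.X : Polynomial ℝ) w b hb hw
  have h1 : Tendsto (fun y : ℝ => (1 - y) ^ 3 * Q.eval y + (1 - y) * y * fx w * Q.eval y)
      (𝓝[<] 1) (𝓝 0) := by
    apply tendsto_nhdsWithin_of_tendsto_nhds
    have : Continuous (fun y : ℝ => (1 - y) ^ 3 * Q.eval y + (1 - y) * y * fx w * Q.eval y) := by
      have := Q.continuous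
      fun_prop
    have h := this.tendsto 1
    simpa using h
  refine h1.congr' ?_
  filter_upwards [self_mem_nhdsWithin] with y hy
  have hy' : 1 - y ≠ 0 := by have : y < 1 := hy; linarith
  rw [sf, ← eval_det, hQ]
  simp only [Polynomial.eval_mul, Polynomial.eval_pow, Polynomial.eval_sub, Polynomial.eval_one,
    Polynomial.eval_X]
  field_simp

theorem lim_nonconj (hα : 3 ≤ Fintype.card α) (w : Equiv.Perm α)
    (hw : ¬ (w.IsCycle ∧ #w.support + 1 = Fintype.card α)) :
    Tendsto (fun y => sf y w) (𝓝[<] 1) (𝓝 0) := by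
  have : Nonempty α := Fintype.card_pos_iff.mp (by omega)
  by_cases hf : ∀ i, w i ≠ i
  · exact lim_nofix w hf
  push Not at hf
  obtain ⟨p, hp⟩ := hf
  have : Nontrivial α := Fintype.one_lt_card_iff_nontrivial.mp (by omega)
  obtain ⟨q, hq⟩ := exists_ne p
  have hpq : ¬ w.SameCycle q p := by
    intro h
    exact hq (h.symm.eq_of_left hp).symm
  have hr : ∃ r, r ≠ p ∧ ¬ w.SameCycle q r := by
    by_contra! hr
    apply hw
    have hs : w.support = {p}ᶜ := by
      ext x
      simp only [Equiv.Perm.mem_support, Finset.mem_compl, Finset.mem_singleton]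
      constructor
      · rintro h rfl; exact h hp
      · intro hx hwx
        have hall : ∀ r, r ≠ p → r = x := by
          intro r hr'
          have h1 := (hr x hx).symm.trans (hr r hr')
          exact (h1.eq_of_left hwx).symm
        have : (univ : Finset α) ⊆ {p, x} := by
          intro r _
          by_cases h : r = p
          · simp [h]
          · simp [hall r h]
        have := Finset.card_le_card this
        have h2 := Finset.card_le_two (a := p) (b := x)
        rw [Finset.card_univ] at this
        omega
    refine ⟨⟨q, ?_, ?_⟩, ?_⟩
    · rw [← Equiv.Perm.mem_support, hs]; simpa using hq
    · intro y hy
      apply hr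
      rintro rfl
      exact hy hp
    · rw [hs, Finset.card_compl, Finset.card_singleton]; omega
  obtain ⟨r, hr1, hr2⟩ := hr
  classical
  refine lim_three w (fun x => if x = p then 0 else if w.SameCycle q x then 1 else 2) ?_ ?_
  · intro a
    fin_cases a
    · exact ⟨p, by simp⟩
    · exact ⟨q, by simp [hq, Equiv.Perm.SameCycle.refl]⟩
    · exact ⟨r, by simp [hr1, hr2]⟩
  · intro i
    have h1 : w i = p ↔ i = p := by
      constructor
      · intro h; apply w.injective; rw [h, hp]
      · rintro rfl; exact hp
    simp only [h1, Equiv.Perm.sameCycle_apply_right]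

noncomputable instance swapFintype : Fintype {t : Equiv.Perm α // t.IsSwap} :=
  Fintype.ofFinite _

/-- sum over tuples of transpositions -/
noncomputable def Z (α : Type*) [Fintype α] [DecidableEq α] (l : ℕ) (φ : Equiv.Perm α → ℝ) : ℝ :=
  ∑ t : Fin l → {t : Equiv.Perm α // t.IsSwap}, φ (List.ofFn fun i => (t i).1).prod

theorem Z_zero (φ : Equiv.Perm α → ℝ) : Z α 0 φ = φ 1 := by
  simp [Z]

theorem Z_succ (l : ℕ) (φ : Equiv.Perm α → ℝ) :
    Z α (l + 1) φ = Z α l (fun w => ∑ a : {t : Equiv.Perm α // t.IsSwap}, φ (a.1 * w)) := by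
  unfold Z
  rw [Finset.sum_comm, ← Fintype.sum_prod_type']
  symm
  refine Fintype.sum_equiv (Fin.consEquiv fun _ => {t : Equiv.Perm α // t.IsSwap}) _ _ ?_
  rintro ⟨a, t⟩
  simp [List.ofFn_succ]

theorem Z_conj (c : Equiv.Perm α) (l : ℕ) : ∀ (φ : Equiv.Perm α → ℝ),
    Z α l (fun w => φ (c * w * c⁻¹)) = Z α l φ := by
  induction l with
  | zero => intro φ; simp [Z_zero]
  | succ l ih =>
    intro φ
    rw [Z_succ, Z_succ,
      ← ih (fun w => ∑ a : {t : Equiv.Perm α // t.IsSwap}, φ (a.1 * w))]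
    congr 1
    ext w
    let e : Equiv.Perm α ≃ Equiv.Perm α := (MulAut.conj c).toEquiv
    have he : ∀ t : Equiv.Perm α, t.IsSwap ↔ (e t).IsSwap := by
      intro t
      have : e t = c * t * c⁻¹ := rfl
      rw [this, ← Equiv.Perm.card_support_eq_two, ← Equiv.Perm.card_support_eq_two,
        Equiv.Perm.card_support_conj]
    refine Fintype.sum_equiv (e.subtypeEquiv he) _ _ ?_
    rintro ⟨a, ha⟩
    have : e a = c * a * c⁻¹ := rfl
    simp only [Equiv.subtypeEquiv_apply, this]
    congr 1
    group

theorem swap_sum (φ : Equiv.Perm α → ℝ) :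
    ∑ i, ∑ j, φ (Equiv.swap i j) = Fintype.card α * φ 1 +
      2 * ∑ a : {t : Equiv.Perm α // t.IsSwap}, φ a.1 := by
  classical
  have h1 : ∀ i j, φ (Equiv.swap i j) = (if i = j then φ 1 else 0) +
      ∑ a : {t : Equiv.Perm α // t.IsSwap}, if Equiv.swap i j = a.1 then φ a.1 else 0 := by
    intro i j
    by_cases h : i = j
    · subst h
      rw [if_pos rfl, Equiv.swap_self, Finset.sum_eq_zero]
      · simp; rfl
      · rintro ⟨a, ha⟩ _
        rw [if_neg]
        rintro h
        obtain ⟨x, y, hxy, rfl⟩ := ha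
        have := congrFun (congrArg DFunLike.coe h) x
        simp at this
        exact hxy this
    · rw [if_neg h, Finset.sum_eq_single ⟨Equiv.swap i j, i, j, h, rfl⟩]
      · simp
      · rintro ⟨a, ha⟩ _ hne
        rw [if_neg]
        rintro rfl
        exact hne rfl
      · simp
  simp only [h1, Finset.sum_add_distrib]
  congr 1
  · simp
  · have hc : ∀ i : α, (∑ j : α, ∑ a : {t : Equiv.Perm α // t.IsSwap},
        if Equiv.swap i j = a.1 then φ a.1 else 0) =
        ∑ a : {t : Equiv.Perm α // t.IsSwap}, ∑ j : α,
          if Equiv.swap i j = a.1 then φ a.1 else 0 := fun i => Finset.sum_comm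
    simp only [hc]
    rw [Finset.sum_comm, Finset.mul_sum]
    refine Finset.sum_congr rfl ?_
    rintro ⟨a, x, y, hxy, rfl⟩ _
    simp only
    rw [← Fintype.sum_prod_type' (f := fun i j => 
      if Equiv.swap i j = Equiv.swap x y then φ (Equiv.swap x y) else 0)]
    rw [← Finset.sum_filter, Finset.sum_const]
    have : ({p : α × α | Equiv.swap p.1 p.2 = Equiv.swap x y} : Finset (α × α)) = {(x, y), (y, x)} := by
      ext ⟨i, j⟩
      simp only [Finset.mem_filter, Finset.mem_univ, true_and, Finset.mem_insert,
        Finset.mem_singleton, Prod.mk.injEq]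
      constructor
      · intro h
        have e1 := congrFun (congrArg DFunLike.coe h) x
        have e2 := congrFun (congrArg DFunLike.coe h) y
        simp only [Equiv.swap_apply_def] at e1 e2
        grind
      · rintro (⟨rfl, rfl⟩ | ⟨rfl, rfl⟩)
        · rfl
        · exact Equiv.swap_comm _ _
    rw [this, Finset.card_pair (by simp [hxy])]
    simp

theorem sf_one {y : ℝ} (hy : y < 1) (n : ℕ) (hn : 2 ≤ n) : sf y (1 : Equiv.Perm (Fin n)) =
    (1 - y) ^ (n - 2) * (1 + ((n : ℝ) - 2) * y + y ^ 2) := by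
  have h1 : cm y (1 : Equiv.Perm (Fin n)) = (1 - y) • (1 : Matrix (Fin n) (Fin n) ℝ) := by
    ext i j
    by_cases h : i = j <;> simp [cm, Matrix.one_apply, h]
  have h2 : fx (1 : Equiv.Perm (Fin n)) = n := by simp [fx]
  rw [sf, h1, h2, Matrix.det_smul]
  obtain ⟨m, rfl⟩ := Nat.exists_eq_add_of_le hn
  have : 1 - y ≠ 0 := by linarith
  simp only [Fintype.card_fin, Matrix.det_one, Nat.add_sub_cancel_left]
  field_simp
  push_cast
  ring

theorem Z_formula (n : ℕ) (N : ℕ) (a : ℕ → ℝ)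
    (h0 : ∀ y : ℝ, 0 < y → y < 1 → sf y (1 : Equiv.Perm (Fin n)) = ∑ j ∈ Finset.range N, a j * y ^ j)
    (l : ℕ) : ∀ y : ℝ, 0 < y → y < 1 → Z (Fin n) l (sf y) =
      ∑ j ∈ Finset.range N, a j * ((n.choose 2 : ℝ) - j * ((n : ℝ) - 1)) ^ l * y ^ j := by
  induction l with
  | zero => intro y hy hy1; simp [Z_zero, h0 y hy hy1]
  | succ l ih =>
    intro y hy hy1
    choose s' hs' hs'' using fun w : Equiv.Perm (Fin n) => key hy hy1 w (n : ℝ) (by simp)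
    have hT : ∀ w, ∑ a : {t : Equiv.Perm (Fin n) // t.IsSwap}, sf y (a.1 * w) =
        (n.choose 2 : ℝ) * sf y w - ((n : ℝ) - 1) * y * s' w := by
      intro w
      have h1 := swap_sum (fun t => sf y (t * w))
      have h2 := hs'' w
      simp only [one_mul, Fintype.card_fin] at h1
      rw [Nat.cast_choose_two]
      linarith
    rw [Z_succ]
    simp only [hT]
    have hD : HasDerivAt (fun z => Z (Fin n) l (sf z)) (Z (Fin n) l s') y := by
      unfold Z
      exact HasDerivAt.fun_sum fun t _ => hs' _
    have hD2 : HasDerivAt (fun z : ℝ => ∑ j ∈ Finset.range N,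
        a j * ((n.choose 2 : ℝ) - j * ((n : ℝ) - 1)) ^ l * z ^ j)
        (∑ j ∈ Finset.range N, a j * ((n.choose 2 : ℝ) - j * ((n : ℝ) - 1)) ^ l *
          (j * y ^ (j - 1))) y :=
      HasDerivAt.fun_sum fun j _ => (hasDerivAt_pow j y).const_mul _
    have hE : Z (Fin n) l s' = ∑ j ∈ Finset.range N,
        a j * ((n.choose 2 : ℝ) - j * ((n : ℝ) - 1)) ^ l * (j * y ^ (j - 1)) := by
      refine hD.unique (hD2.congr_of_eventuallyEq ?_)
      filter_upwards [Ioo_mem_nhds hy hy1] with z hz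
      exact ih z hz.1 hz.2
    have hZ : Z (Fin n) l (fun w => (n.choose 2 : ℝ) * sf y w - ((n : ℝ) - 1) * y * s' w) =
        (n.choose 2 : ℝ) * Z (Fin n) l (sf y) - ((n : ℝ) - 1) * y * Z (Fin n) l s' := by
      simp only [Z, Finset.sum_sub_distrib, Finset.mul_sum]
    rw [hZ, hE, ih y hy hy1, Finset.mul_sum, Finset.mul_sum, ← Finset.sum_sub_distrib]
    refine Finset.sum_congr rfl fun j _ => ?_
    rcases j with _ | j
    · simp; ring
    · simp only [Nat.add_sub_cancel]
      rw [pow_succ y j]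
      ring

theorem card_conj (n : ℕ) (hn : 2 ≤ n) (g : Equiv.Perm (Fin n))
    (hg : g.IsCycle ∧ g.support.card = n - 1) (w : Equiv.Perm (Fin n))
    (hw : w.IsCycle ∧ #w.support + 1 = Fintype.card (Fin n)) :
    #{c : Equiv.Perm (Fin n) | c * w * c⁻¹ = g} = n - 1 := by
  rw [Fintype.card_fin] at hw
  have hconj : IsConj w g := by
    rw [Equiv.Perm.isConj_iff_cycleType_eq, hw.1.cycleType, hg.1.cycleType, hg.2]
    congr 1; omega
  obtain ⟨d, hd⟩ := isConj_iff.mp hconj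
  have h1 : #{c : Equiv.Perm (Fin n) | c * w * c⁻¹ = g} =
      Nat.card (Subgroup.centralizer ({g} : Set (Equiv.Perm (Fin n)))) := by
    rw [← Fintype.card_subtype, ← Nat.card_eq_fintype_card]
    refine Nat.card_congr ((Equiv.mulRight d⁻¹).subtypeEquiv ?_)
    intro c
    rw [Subgroup.mem_centralizer_singleton_iff]
    simp only [Equiv.coe_mulRight]
    rw [← hd]
    constructor
    · intro h
      have : c * w = d * w * d⁻¹ * c := by rw [← h]; group
      calc c * d⁻¹ * (d * w * d⁻¹) = c * w * d⁻¹ := by group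
        _ = _ := by rw [this]; group
    · intro h
      have h2 : c * w * d⁻¹ = (d * w * d⁻¹) * (c * d⁻¹) := by rw [← h]; group
      calc c * w * c⁻¹ = (c * w * d⁻¹) * d * c⁻¹ := by group
        _ = _ := by rw [h2]; group
  rw [h1, Equiv.Perm.nat_card_centralizer, hg.1.cycleType, hg.2]
  simp
  rw [show n - (n - 1) = 1 by omega]
  simp

theorem main_real (n : ℕ) (hn : 2 ≤ n) (g : Equiv.Perm (Fin n))
    (hg : g.IsCycle ∧ g.support.card = n - 1) (l : ℕ) (a : ℕ → ℝ) (N : ℕ)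
    (h0 : ∀ y : ℝ, 0 < y → y < 1 → sf y (1 : Equiv.Perm (Fin n)) = ∑ j ∈ Finset.range N, a j * y ^ j) :
    (n.factorial : ℝ) * Z (Fin n) l (fun w => if w = g then 1 else 0) =
      ∑ j ∈ Finset.range N, a j * ((n.choose 2 : ℝ) - j * ((n : ℝ) - 1)) ^ l := by
  classical
  have hn3 : 3 ≤ n := by
    have := hg.1.two_le_card_support
    omega
  have hlim : Tendsto (fun y => Z (Fin n) l (sf y)) (𝓝[<] 1)
      (𝓝 (Z (Fin n) l (fun w => (#{c : Equiv.Perm (Fin n) | c * w * c⁻¹ = g} : ℝ)))) := by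
    unfold Z
    refine tendsto_finsetSum _ fun t _ => ?_
    generalize (List.ofFn fun i => (t i).1).prod = w
    beta_reduce
    by_cases hw : w.IsCycle ∧ #w.support + 1 = Fintype.card (Fin n)
    · rw [card_conj n hn g hg w hw]
      have h := lim_conj w hw.1 hw.2
      have e : #w.support = n - 1 := by have := hw.2; rw [Fintype.card_fin] at this; omega
      rwa [e] at h
    · have : #{c : Equiv.Perm (Fin n) | c * w * c⁻¹ = g} = 0 := by
        rw [Finset.card_eq_zero, Finset.filter_eq_empty_iff]
        intro c _ hc
        apply hw
        rw [← hc] at hg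
        rw [Equiv.Perm.card_support_conj] at hg
        refine ⟨?_, by rw [hg.2, Fintype.card_fin]; omega⟩
        have := hg.1.conj (g := c⁻¹)
        convert this using 1
        group
      rw [this, Nat.cast_zero]
      exact lim_nonconj (by simpa using hn3) w hw
  have hlim2 : Tendsto (fun y => Z (Fin n) l (sf y)) (𝓝[<] 1)
      (𝓝 (∑ j ∈ Finset.range N, a j * ((n.choose 2 : ℝ) - j * ((n : ℝ) - 1)) ^ l)) := by
    have h1 : Tendsto (fun y : ℝ => ∑ j ∈ Finset.range N,
        a j * ((n.choose 2 : ℝ) - j * ((n : ℝ) - 1)) ^ l * y ^ j) (𝓝[<] 1)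
      (𝓝 (∑ j ∈ Finset.range N, a j * ((n.choose 2 : ℝ) - j * ((n : ℝ) - 1)) ^ l)) := by
      apply tendsto_nhdsWithin_of_tendsto_nhds
      have : Continuous (fun y : ℝ => ∑ j ∈ Finset.range N,
        a j * ((n.choose 2 : ℝ) - j * ((n : ℝ) - 1)) ^ l * y ^ j) := by fun_prop
      have h := this.tendsto 1
      simpa using h
    refine h1.congr' ?_
    filter_upwards [Ioo_mem_nhdsLT (show (0:ℝ) < 1 by norm_num)] with y hy
    exact (Z_formula n N a h0 l y hy.1 hy.2).symm
  rw [← tendsto_nhds_unique hlim hlim2]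
  have h1 : Z (Fin n) l (fun w => (#{c : Equiv.Perm (Fin n) | c * w * c⁻¹ = g} : ℝ)) =
      ∑ c : Equiv.Perm (Fin n), Z (Fin n) l (fun w => if c * w * c⁻¹ = g then 1 else 0) := by
    simp only [Z]
    rw [Finset.sum_comm]
    simp
  rw [h1]
  have h2 : ∀ c : Equiv.Perm (Fin n), Z (Fin n) l (fun w => if c * w * c⁻¹ = g then 1 else 0) =
    Z (Fin n) l (fun w => if w = g then 1 else 0) := fun c =>
      Z_conj c l (fun w => if w = g then 1 else 0)
  simp [h2, Fintype.card_perm]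

theorem Z_card (n : ℕ) (g : Equiv.Perm (Fin n)) (l : ℕ) :
    Z (Fin n) l (fun w => if w = g then 1 else 0) = Nat.card {t : Fin l → Equiv.Perm (Fin n) //
        (∀ i, (t i).IsSwap) ∧ (List.ofFn t).prod = g} := by
  classical
  have e : {t : Fin l → Equiv.Perm (Fin n) // (∀ i, (t i).IsSwap) ∧ (List.ofFn t).prod = g} ≃
      {t : Fin l → {t : Equiv.Perm (Fin n) // t.IsSwap} // (List.ofFn fun i => (t i).1).prod = g} :=
    { toFun := fun t => ⟨fun i => ⟨t.1 i, t.2.1 i⟩, t.2.2⟩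
      invFun := fun t => ⟨fun i => (t.1 i).1, fun i => (t.1 i).2, t.2⟩
      left_inv := fun t => rfl
      right_inv := fun t => rfl }
  rw [Nat.card_congr e, Nat.card_eq_fintype_card, Fintype.card_subtype]
  simp [Z]

end ALC

/-- For the regular element `g = (12⋯(n−1))(n) ∈ S_n`, the structural polynomial is
`Φ(X) = 1 + (n−2)X + X²`: with `a_j` the coefficients of
`(1 − X)^{n−2}·(1 + (n−2)X + X²)`, the number of `l`-tuples of transpositions with
product `g` satisfies `n! · Fact(l) = Σ_{j=0}^{n} a_j (n(n−1)/2 − j(n−1))^l`. -/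
theorem factorizations_of_almost_long_cycle_Phi
    (n : ℕ) (hn : 2 ≤ n) (g : Equiv.Perm (Fin n))
    (hg : g.IsCycle ∧ g.support.card = n - 1) (l : ℕ) :
    (n.factorial : ℤ) *
      Nat.card {t : Fin l → Equiv.Perm (Fin n) //
        (∀ i, (t i).IsSwap) ∧ (List.ofFn t).prod = g} =
      ∑ j ∈ Finset.range (n + 1),
        ((1 - Polynomial.X) ^ (n - 2) *
          (1 + Polynomial.C ((n : ℤ) - 2) * Polynomial.X + Polynomial.X ^ 2)).coeff j *
          ((n.choose 2 : ℤ) - j * ((n : ℤ) - 1)) ^ l := by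
  set p : Polynomial ℤ := (1 - Polynomial.X) ^ (n - 2) *
          (1 + Polynomial.C ((n : ℤ) - 2) * Polynomial.X + Polynomial.X ^ 2) with hp
  have hdeg : p.natDegree < n + 1 := by
    have h1 : ((1 - Polynomial.X : Polynomial ℤ) ^ (n - 2)).natDegree ≤ (n - 2) * 1 := 
      Polynomial.natDegree_pow_le_of_le _ (by compute_degree)
    have h2 : (1 + Polynomial.C ((n : ℤ) - 2) * Polynomial.X + Polynomial.X ^ 2 :
        Polynomial ℤ).natDegree ≤ 2 := by compute_degree
    have h3 : p.natDegree ≤ (n - 2) * 1 + 2 := Polynomial.natDegree_mul_le_of_le h1 h2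
    omega
  have h0 : ∀ y : ℝ, 0 < y → y < 1 → ALC.sf y (1 : Equiv.Perm (Fin n)) =
      ∑ j ∈ Finset.range (n + 1), ((p.coeff j : ℤ) : ℝ) * y ^ j := by
    intro y _ hy1
    have h1 : p.eval₂ (Int.castRingHom ℝ) y = ∑ j ∈ Finset.range (n + 1), ((p.coeff j : ℤ) : ℝ) * y ^ j := by
      rw [Polynomial.eval₂_eq_sum_range' _ hdeg]
      simp
    rw [← h1, ALC.sf_one hy1 n hn, hp]
    simp [Polynomial.eval₂_mul, Polynomial.eval₂_pow]
  have := ALC.main_real n hn g hg l (fun j => ((p.coeff j : ℤ) : ℝ)) (n + 1) h0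
  rw [ALC.Z_card] at this
  exact_mod_cast this
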